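/- Let b ≥ 2 be an integer. A real number x is normal in base b if and only if the sequence ({b^n x})_{n≥1} is uniformly distributed modulo 1, where a sequence (x_n) in [0,1) is uniformly distributed if for every subinterval [u,v) ⊆ [0,1), (1/N)·#{n ≤ N : x_n ∈ [u,v)} → v − u. -/

import Mathlib

open Filter

lemma wall_shift_count (P : ℕ → Prop) [DecidablePred P] (N : ℕ) :
    ((Finset.Icc 1 N).filter (fun n => P (n - 1))).card + (if P N then 1 else 0)
      = ((Finset.Icc 1 N).filter (fun n => P n)).card + (if P 0 then 1 else 0) := by
  induction N with
  | zero => simp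
  | succ k ih =>
    rw [← Finset.insert_Icc_right_eq_Icc_add_one (by omega), Finset.filter_insert,
      Finset.filter_insert]
    simp only [Nat.add_sub_cancel]
    split_ifs at * <;> simp_all

lemma wall_shift (P : ℕ → Prop) [DecidablePred P] (L : ℝ) :
    Tendsto (fun N : ℕ => (((Finset.Icc 1 N).filter (fun n => P (n - 1))).card : ℝ) / (N : ℝ))
      atTop (nhds L) ↔
    Tendsto (fun N : ℕ => (((Finset.Icc 1 N).filter (fun n => P n)).card : ℝ) / (N : ℝ))
      atTop (nhds L) := by
  have key : Tendsto (fun N : ℕ =>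
      (((Finset.Icc 1 N).filter (fun n => P (n - 1))).card : ℝ) / (N : ℝ) -
      (((Finset.Icc 1 N).filter (fun n => P n)).card : ℝ) / (N : ℝ)) atTop (nhds 0) := by
    apply squeeze_zero_norm (a := fun N : ℕ => 1 / (N : ℝ)) _ tendsto_one_div_atTop_nhds_zero_nat
    intro N
    have h := wall_shift_count P N
    have h' : |(((Finset.Icc 1 N).filter (fun n => P (n - 1))).card : ℝ) -
      (((Finset.Icc 1 N).filter (fun n => P n)).card : ℝ)| ≤ 1 := by
      rw [abs_le]
      constructor
      · rw [neg_le_sub_iff_le_add]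
        norm_cast
        split_ifs at h <;> omega
      · rw [sub_le_iff_le_add]
        norm_cast
        split_ifs at h <;> omega
    rw [← sub_div, Real.norm_eq_abs, abs_div, Nat.abs_cast]
    gcongr
  constructor
  · intro h
    have := h.sub key
    simpa using this
  · intro h
    have := h.add key
    simpa using this

lemma wall_fract (b : ℕ) (z : ℝ) (i : ℕ) :
    Int.fract ((b : ℝ) ^ i * z) = Int.fract ((b : ℝ) ^ i * Int.fract z) := by
  rw [Int.fract_eq_fract]
  refine ⟨(b : ℤ) ^ i * ⌊z⌋, ?_⟩
  push_cast
  rw [← mul_sub, Int.self_sub_fract]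

/-- The `i`-th digit in terms of the integer part of `b ^ m * y`. -/
lemma wall_digit (b : ℕ) (hb : 2 ≤ b) (y : ℝ) (hy : 0 ≤ y) (m i : ℕ) (hi : i < m) :
    ⌊(b : ℝ) * Int.fract ((b : ℝ) ^ i * y)⌋
      = ((⌊(b : ℝ) ^ m * y⌋₊ / b ^ (m - 1 - i) % b : ℕ) : ℤ) := by
  have hb0 : (0 : ℝ) < b := by positivity
  have h1 : ⌊(b : ℝ) ^ m * y⌋₊ / b ^ (m - 1 - i) = ⌊(b : ℝ) ^ (i + 1) * y⌋₊ := by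
    rw [← Nat.floor_div_natCast]
    congr 1
    have : m = (i + 1) + (m - 1 - i) := by omega
    nth_rewrite 1 [this]
    push_cast
    rw [pow_add]
    field_simp
  have h2 : ⌊(b : ℝ) ^ i * y⌋₊ = ⌊(b : ℝ) ^ (i + 1) * y⌋₊ / b := by
    rw [← Nat.floor_div_natCast]
    congr 1
    rw [pow_succ]
    field_simp
  rw [h1]
  have h3 : (b : ℝ) * Int.fract ((b : ℝ) ^ i * y)
      = (b : ℝ) ^ (i + 1) * y - (((b * ⌊(b : ℝ) ^ i * y⌋₊ : ℕ) : ℤ) : ℝ) := by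
    rw [← Int.self_sub_floor, ← natCast_floor_eq_intCast_floor (by positivity)]
    push_cast
    ring
  rw [h3, Int.floor_sub_intCast, ← Int.natCast_floor_eq_floor (by positivity), h2]
  have := Nat.mod_add_div ⌊(b : ℝ) ^ (i + 1) * y⌋₊ b
  zify at this ⊢
  linarith

lemma wall_cyl (b : ℕ) (hb : 2 ≤ b) (x : ℝ) (m : ℕ) (s : Fin m → Fin b) (n : ℕ) (hn : 1 ≤ n) :
    (∀ i : Fin m, ⌊(b : ℝ) * Int.fract ((b : ℝ) ^ (n + i.val - 1) * x)⌋ = ((s i : ℕ) : ℤ)) ↔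
    ((finFunctionFinEquiv (fun i => s i.rev) : ℕ) : ℝ) / (b : ℝ) ^ m
        ≤ Int.fract ((b : ℝ) ^ (n - 1) * x) ∧
      Int.fract ((b : ℝ) ^ (n - 1) * x)
        < (((finFunctionFinEquiv (fun i => s i.rev) : ℕ) : ℝ) + 1) / (b : ℝ) ^ m := by
  have hb0 : (0 : ℝ) < b := by positivity
  have hbm : (0 : ℝ) < (b : ℝ) ^ m := by positivity
  set y := Int.fract ((b : ℝ) ^ (n - 1) * x) with hy
  have hy0 : 0 ≤ y := Int.fract_nonneg _
  have hy1 : y < 1 := Int.fract_lt_one _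
  have hd : ∀ i : Fin m, ⌊(b : ℝ) * Int.fract ((b : ℝ) ^ (n + i.val - 1) * x)⌋ =
      ((⌊(b : ℝ) ^ m * y⌋₊ / b ^ (m - 1 - i) % b : ℕ) : ℤ) := by
    intro i
    rw [← wall_digit b hb y hy0 m i i.2, hy, ← wall_fract, ← mul_assoc, ← pow_add]
    congr 5
    omega
  have hlt : ⌊(b : ℝ) ^ m * y⌋₊ < b ^ m := by
    rw [Nat.floor_lt (by positivity)]
    push_cast
    nlinarith
  have e : (∀ i : Fin m, ⌊(b : ℝ) * Int.fract ((b : ℝ) ^ (n + i.val - 1) * x)⌋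
        = ((s i : ℕ) : ℤ)) ↔
      ⌊(b : ℝ) ^ m * y⌋₊ = (finFunctionFinEquiv (fun i => s i.rev) : ℕ) := by
    have e1 : ⌊(b : ℝ) ^ m * y⌋₊ = (finFunctionFinEquiv (fun i => s i.rev) : ℕ) ↔
        finFunctionFinEquiv.symm (⟨⌊(b : ℝ) ^ m * y⌋₊, hlt⟩ : Fin (b ^ m))
          = (fun i => s i.rev) := by
      rw [Equiv.symm_apply_eq, Fin.ext_iff]
    rw [e1, funext_iff, ← (Fin.revPerm).forall_congr_right]
    apply forall_congr'
    intro i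
    rw [hd, Fin.ext_iff]
    simp only [finFunctionFinEquiv, Equiv.ofRightInverseOfCardLE, Fin.revPerm_apply, Fin.val_rev]
    have : m - 1 - (m - (i.val + 1)) = i.val := by omega
    rw [this]
    norm_cast
  rw [e, Nat.floor_eq_iff (by positivity), div_le_iff₀ hbm, lt_div_iff₀ hbm, mul_comm y]

/-- Counting function. -/
noncomputable def wallC (b : ℕ) (x u v : ℝ) (N : ℕ) : ℝ :=
  (((Finset.Icc 1 N).filter (fun n : ℕ =>
      u ≤ Int.fract ((b : ℝ) ^ n * x) ∧ Int.fract ((b : ℝ) ^ n * x) < v)).card : ℝ) / (N : ℝ)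

lemma wallC_add (b : ℕ) (x u v w : ℝ) (h1 : u ≤ v) (h2 : v ≤ w) (N : ℕ) :
    wallC b x u w N = wallC b x u v N + wallC b x v w N := by
  unfold wallC
  rw [← add_div]
  congr 1
  rw [← Nat.cast_add, ← Finset.card_union_of_disjoint]
  · congr 2
    ext n
    simp only [Finset.mem_filter, Finset.mem_union]
    constructor
    · rintro ⟨a, c, d⟩
      rcases lt_or_ge (Int.fract ((b : ℝ) ^ n * x)) v with h | h
      · exact Or.inl ⟨a, c, h⟩
      · exact Or.inr ⟨a, h, d⟩
    · rintro (⟨a, c, d⟩ | ⟨a, c, d⟩)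
      · exact ⟨a, c, d.trans_le h2⟩
      · exact ⟨a, h1.trans c, d⟩
  · rw [Finset.disjoint_left]
    intro n h h'
    simp only [Finset.mem_filter] at h h'
    linarith [h.2.2, h'.2.1]

lemma wallC_nonneg (b : ℕ) (x u v : ℝ) (N : ℕ) : 0 ≤ wallC b x u v N := by
  unfold wallC; positivity

lemma wall_string_iff (b : ℕ) (hb : 2 ≤ b) (x : ℝ) (m : ℕ) (s : Fin m → Fin b) (L : ℝ) :
    Tendsto (fun N : ℕ =>
          (((Finset.Icc 1 N).filter (fun n : ℕ =>
              ∀ i : Fin m, ⌊(b : ℝ) * Int.fract ((b : ℝ) ^ (n + i.val - 1) * x)⌋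
                = ((s i : ℕ) : ℤ))).card : ℝ)
            / (N : ℝ)) atTop (nhds L) ↔
    Tendsto (wallC b x (((finFunctionFinEquiv (fun i => s i.rev) : ℕ) : ℝ) / (b : ℝ) ^ m)
      ((((finFunctionFinEquiv (fun i => s i.rev) : ℕ) : ℝ) + 1) / (b : ℝ) ^ m))
      atTop (nhds L) := by
  unfold wallC
  rw [← wall_shift (fun n : ℕ =>
    ((finFunctionFinEquiv (fun i => s i.rev) : ℕ) : ℝ) / (b : ℝ) ^ m
        ≤ Int.fract ((b : ℝ) ^ n * x) ∧
      Int.fract ((b : ℝ) ^ n * x)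
        < (((finFunctionFinEquiv (fun i => s i.rev) : ℕ) : ℝ) + 1) / (b : ℝ) ^ m)]
  apply iff_of_eq
  congr 1
  ext N
  congr 3
  apply Finset.filter_congr
  intro n hn
  exact wall_cyl b hb x m s n (Finset.mem_Icc.1 hn).1

theorem stmt_16 (b : ℕ) (hb : 2 ≤ b) (x : ℝ) :
    (∀ (m : ℕ), 0 < m → ∀ s : Fin m → Fin b,
      Tendsto (fun N : ℕ =>
          (((Finset.Icc 1 N).filter (fun n : ℕ =>
              ∀ i : Fin m, ⌊(b : ℝ) * Int.fract ((b : ℝ) ^ (n + i.val - 1) * x)⌋ = ((s i : ℕ) : ℤ))).card : ℝ)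
            / (N : ℝ))
        atTop (nhds ((b : ℝ) ^ (-(m : ℤ)))))
    ↔
    (∀ u v : ℝ, 0 ≤ u → u < v → v ≤ 1 →
      Tendsto (fun N : ℕ =>
          (((Finset.Icc 1 N).filter (fun n : ℕ =>
              u ≤ Int.fract ((b : ℝ) ^ n * x) ∧ Int.fract ((b : ℝ) ^ n * x) < v)).card : ℝ)
            / (N : ℝ))
        atTop (nhds (v - u))) := by
  have hb0 : (0 : ℝ) < b := by positivity
  have hb1 : (1 : ℝ) < b := by exact_mod_cast hb
  constructor
  · intro H
    have H1 : ∀ m : ℕ, 0 < m → ∀ K : ℕ, K < b ^ m →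
        Tendsto (wallC b x ((K : ℝ) / (b : ℝ) ^ m) (((K : ℝ) + 1) / (b : ℝ) ^ m)) atTop
          (nhds (1 / (b : ℝ) ^ m)) := by
      intro m hm K hK
      have h := (wall_string_iff b hb x m
        (fun i => finFunctionFinEquiv.symm (⟨K, hK⟩ : Fin (b ^ m)) i.rev) _).1 (H m hm _)
      simp only [Fin.rev_rev] at h
      rw [Equiv.apply_symm_apply] at h
      simpa using h
    have H2 : ∀ m : ℕ, 0 < m → ∀ K : ℕ, K ≤ b ^ m →
        Tendsto (wallC b x 0 ((K : ℝ) / (b : ℝ) ^ m)) atTop (nhds ((K : ℝ) / (b : ℝ) ^ m)) := by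
      intro m hm K
      induction K with
      | zero =>
        intro _
        have : wallC b x 0 (((0 : ℕ) : ℝ) / (b : ℝ) ^ m) = fun _ => 0 := by
          funext N
          unfold wallC
          rw [Finset.filter_false_of_mem]
          · simp
          · intro n _ h
            rw [Nat.cast_zero, zero_div] at h
            linarith [h.2, h.1]
        rw [this]
        simp
      | succ K ih =>
        intro hK
        have h := (ih (by omega)).add (H1 m hm K (by omega))
        have e : wallC b x 0 (((K + 1 : ℕ) : ℝ) / (b : ℝ) ^ m) = fun N =>
            wallC b x 0 ((K : ℝ) / (b : ℝ) ^ m) N +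
            wallC b x ((K : ℝ) / (b : ℝ) ^ m) (((K : ℝ) + 1) / (b : ℝ) ^ m) N := by
          funext N
          push_cast
          apply wallC_add
          · positivity
          · gcongr
            linarith
        rw [e]
        convert h using 2
        push_cast
        ring
    have H3 : ∀ v : ℝ, 0 ≤ v → v ≤ 1 → Tendsto (wallC b x 0 v) atTop (nhds v) := by
      intro v hv0 hv1
      rcases hv1.eq_or_lt with rfl | hv1
      · have := H2 1 one_pos (b ^ 1) le_rfl
        push_cast at this
        rwa [div_self (by positivity)] at this
      rw [Metric.tendsto_atTop]
      intro ε hε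
      obtain ⟨m0, hm0⟩ := exists_pow_lt_of_lt_one (half_pos hε)
        (show (1 / (b : ℝ)) < 1 by rw [div_lt_one hb0]; exact hb1)
      set m := m0 + 1 with hm
      have hbm : (0 : ℝ) < (b : ℝ) ^ m := by positivity
      have hsmall : 1 / (b : ℝ) ^ m < ε / 2 := by
        refine lt_of_le_of_lt ?_ hm0
        rw [div_pow, one_pow]
        apply one_div_le_one_div_of_le (by positivity)
        exact pow_le_pow_right₀ hb1.le (by omega)
      set j := ⌊v * (b : ℝ) ^ m⌋₊ with hj
      have hj1 : (j : ℝ) / (b : ℝ) ^ m ≤ v := by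
        rw [div_le_iff₀ hbm]; exact Nat.floor_le (by positivity)
      have hj2 : v < ((j + 1 : ℕ) : ℝ) / (b : ℝ) ^ m := by
        rw [lt_div_iff₀ hbm]; push_cast; exact Nat.lt_floor_add_one _
      have hj3 : j < b ^ m := by
        rw [hj, Nat.floor_lt (by positivity)]
        push_cast
        nlinarith
      have a1 := H2 m (by omega) j hj3.le
      have a2 := H2 m (by omega) (j + 1) hj3
      rw [Metric.tendsto_atTop] at a1 a2
      obtain ⟨N1, hN1⟩ := a1 _ (half_pos hε)
      obtain ⟨N2, hN2⟩ := a2 _ (half_pos hε)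
      refine ⟨max N1 N2, fun N hN => ?_⟩
      have c1 := hN1 N (le_trans (le_max_left _ _) hN)
      have c2 := hN2 N (le_trans (le_max_right _ _) hN)
      have d1 := wallC_add b x 0 _ v (by positivity) hj1 N
      have d2 := wallC_add b x 0 v _ hv0 hj2.le N
      have p1 := wallC_nonneg b x ((j : ℝ) / (b : ℝ) ^ m) v N
      have p2 := wallC_nonneg b x v (((j + 1 : ℕ) : ℝ) / (b : ℝ) ^ m) N
      have q : ((j + 1 : ℕ) : ℝ) / (b : ℝ) ^ m = (j : ℝ) / (b : ℝ) ^ m + 1 / (b : ℝ) ^ m := by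
        push_cast; ring
      rw [Real.dist_eq, abs_lt] at c1 c2 ⊢
      constructor <;> linarith [c1.1, c2.2]
    intro u v hu huv hv
    have h := (H3 v (by linarith) hv).sub (H3 u hu (by linarith))
    refine h.congr (fun N => ?_)
    rw [wallC_add b x 0 u v hu huv.le N, add_sub_cancel_left]
    rfl
  · intro H m hm s
    rw [wall_string_iff b hb]
    set K := finFunctionFinEquiv (fun i => s i.rev) with hK
    have hbm : (0 : ℝ) < (b : ℝ) ^ m := by positivity
    have hKlt : (((K : ℕ) : ℝ) + 1) ≤ (b : ℝ) ^ m := by exact_mod_cast K.2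
    have h := H (((K : ℕ) : ℝ) / (b : ℝ) ^ m) ((((K : ℕ) : ℝ) + 1) / (b : ℝ) ^ m)
      (by positivity) (by gcongr; linarith) (by rw [div_le_one hbm]; exact hKlt)
    have e : (b : ℝ) ^ (-(m : ℤ)) = (((K : ℕ) : ℝ) + 1) / (b : ℝ) ^ m
        - ((K : ℕ) : ℝ) / (b : ℝ) ^ m := by
      rw [zpow_neg, zpow_natCast]; field_simp; ring
    rw [e]
    exact h
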